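/- Let g be a finite-dimensional perfect complex Lie algebra whose solvable radical a is nonzero and abelian, with a semisimple subalgebra s such that g = a ⊕ s as vector spaces, and such that a is an irreducible s-module. Assume furthermore that every linear map φ : g → g satisfying [φ(x),y] + [x,φ(y)] = 0 for all x,y ∈ g is zero. Then any commutative post-Lie algebra structure on g is trivial. -/

import Mathlib

/-- A commutative post-Lie algebra structure on a Lie algebra `L`, given by a bilinear
product `p`. -/
structure IsCommPostLieStruct {k L : Type*} [CommRing k] [LieRing L] [LieAlgebra k L]
    (p : L →ₗ[k] L →ₗ[k] L) : Prop where
  comm : ∀ x y : L, p x y = p y x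
  ax2 : ∀ x y z : L, p ⁅x, y⁆ z = p x (p y z) - p y (p x z)
  ax3 : ∀ x y z : L, p x ⁅y, z⁆ = ⁅p x y, z⁆ + ⁅y, p x z⁆

/-- The action of `g` on an ideal `a`, viewed as a map into the subtype `a`. -/
def LieIdeal.bracketAction {g : Type*} [LieRing g] [LieAlgebra ℂ g] (a : LieIdeal ℂ g)
    (x : g) (w : a) : a :=
  ⟨⁅x, (w : g)⁆, a.lie_mem w.2⟩

theorem perfect_zero_aux {g V : Type*} [LieRing g] [LieAlgebra ℂ g] [AddCommGroup V] [Module ℂ V]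
    (hperf : ⁅(⊤ : LieIdeal ℂ g), (⊤ : LieIdeal ℂ g)⁆ = (⊤ : LieIdeal ℂ g))
    (f : g →ₗ[ℂ] V) (hf : ∀ x y : g, f ⁅x, y⁆ = 0) (z : g) : f z = 0 := by
  have hz : z ∈ (⁅(⊤ : LieIdeal ℂ g), (⊤ : LieIdeal ℂ g)⁆ : LieIdeal ℂ g) := by
    rw [hperf]; exact LieSubmodule.mem_top z
  rw [← LieSubmodule.mem_toSubmodule, LieSubmodule.lieIdeal_oper_eq_linear_span'] at hz
  have hle : Submodule.span ℂ {⁅x, n⁆ | (x ∈ (⊤ : LieIdeal ℂ g)) (n ∈ (⊤ : LieIdeal ℂ g))}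
      ≤ LinearMap.ker f := by
    rw [Submodule.span_le]
    rintro _ ⟨x, -, y, -, rfl⟩
    exact hf x y
  exact hle hz

/-- Derivations are skew for the Killing form. -/
theorem killing_skew_aux {g : Type*} [LieRing g] [LieAlgebra ℂ g]
    (D : g →ₗ[ℂ] g) (hD : ∀ y z : g, D ⁅y, z⁆ = ⁅D y, z⁆ + ⁅y, D z⁆) (y z : g) :
    killingForm ℂ g (D y) z = - killingForm ℂ g y (D z) := by
  have h : ∀ y, LieAlgebra.ad ℂ g (D y)
      = D ∘ₗ LieAlgebra.ad ℂ g y - LieAlgebra.ad ℂ g y ∘ₗ D := by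
    intro y
    ext w
    simp [hD]
  rw [killingForm_apply_apply, killingForm_apply_apply, h y, h z]
  have e1 := LinearMap.trace_mul_cycle ℂ D (LieAlgebra.ad ℂ g y) (LieAlgebra.ad ℂ g z)
  have e2 := LinearMap.trace_mul_cycle ℂ (LieAlgebra.ad ℂ g y) (LieAlgebra.ad ℂ g z) D
  simp only [LinearMap.sub_comp, LinearMap.comp_sub, map_sub]
  simp only [Module.End.mul_eq_comp, LinearMap.comp_assoc] at e1 e2 ⊢
  rw [e2]
  ring

/-- Let `g = a ⋊ s` be a perfect Lie algebra with nonzero abelian radical `a` which is an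
irreducible `s`-module, and suppose every linear map `φ : g → g` with
`[φ(x), y] + [x, φ(y)] = 0` for all `x, y` vanishes.  Then any commutative post-Lie algebra
structure on `g` is trivial. -/
theorem statement13 (g : Type*) [LieRing g] [LieAlgebra ℂ g] [FiniteDimensional ℂ g]
    (hperf : ⁅(⊤ : LieIdeal ℂ g), (⊤ : LieIdeal ℂ g)⁆ = (⊤ : LieIdeal ℂ g))
    (a : LieIdeal ℂ g) (ha : a = LieAlgebra.radical ℂ g) (hne : a ≠ ⊥)
    (habel : ∀ x ∈ a, ∀ y ∈ a, ⁅x, y⁆ = (0 : g))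
    (s : LieSubalgebra ℂ g) [LieAlgebra.IsSemisimple ℂ s]
    (hcompl : IsCompl a.toSubmodule s.toSubmodule)
    (hirr : ∀ U : Submodule ℂ a,
      (∀ x ∈ s, ∀ w ∈ U, a.bracketAction x w ∈ U) → U = ⊥ ∨ U = ⊤)
    (hphi : ∀ φ : g →ₗ[ℂ] g, (∀ x y : g, ⁅φ x, y⁆ + ⁅x, φ y⁆ = 0) → φ = 0)
    (p : g →ₗ[ℂ] g →ₗ[ℂ] g) (hp : IsCommPostLieStruct p) :
    ∀ x y : g, p x y = 0 := by
  have hpa : ∀ x y : g, p x y ∈ a := by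
    intro x y
    rw [ha]
    apply LieAlgebra.killingCompl_top_le_radical ℂ g
    rw [LieIdeal.mem_killingCompl]
    intro z _
    rw [LieModule.traceForm_comm]
    have sk : ∀ x y z, killingForm ℂ g (p x y) z = - killingForm ℂ g (p x z) y := by
      intro x y z
      rw [killing_skew_aux (p x) (hp.ax3 x) y z, LieModule.traceForm_comm]
    have e1 := sk x y z
    have e2 := sk y x z
    have e3 := sk z x y
    rw [hp.comm y x] at e2
    rw [hp.comm z x, hp.comm z y] at e3
    linear_combination (1/2 : ℂ) * (e1 + e2 - e3)
  -- each `p x` acts on `a` by a scalar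
  have hsc : ∀ x : g, ∃ c : ℂ, ∀ b ∈ a, p x b = c • b := by
    intro x
    let D : Module.End ℂ a := ((p x).comp a.toSubmodule.subtype).codRestrict a.toSubmodule
      (fun b => hpa x b)
    have hDc : ∀ b : a, ((D b : a) : g) = p x b := fun b => rfl
    have : Nontrivial a := by
      rw [LieSubmodule.nontrivial_iff_ne_bot]; exact hne
    have : FiniteDimensional ℂ a := inferInstanceAs (FiniteDimensional ℂ a.toSubmodule)
    obtain ⟨c, hc⟩ := Module.End.exists_eigenvalue D
    refine ⟨c, fun b hb => ?_⟩
    have htop : D.eigenspace c = ⊤ := by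
      refine (hirr (D.eigenspace c) ?_).resolve_left hc
      intro y hy w hw
      rw [Module.End.mem_eigenspace_iff] at hw ⊢
      apply Subtype.ext
      have hw' : p x (w : g) = c • (w : g) := by
        rw [← hDc, hw]; rfl
      rw [hDc]
      change p x ⁅y, (w : g)⁆ = c • ⁅y, (w : g)⁆
      rw [hp.ax3, habel _ (hpa x y) _ w.2, hw', lie_smul, zero_add]
    have hm : (⟨b, hb⟩ : a) ∈ D.eigenspace c := by rw [htop]; trivial
    rw [Module.End.mem_eigenspace_iff] at hm
    have := congrArg (fun t : a => (t : g)) hm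
    exact this
  have hza : ∀ b ∈ a, ∀ x, p x b = 0 := by
    intro b hb x
    refine perfect_zero_aux hperf (p.flip b) (fun u v => ?_) x
    obtain ⟨c, hc⟩ := hsc u
    obtain ⟨d, hd⟩ := hsc v
    rw [LinearMap.flip_apply, hp.ax2, hc b hb, hd b hb, map_smul, map_smul, hc b hb, hd b hb,
      smul_comm, sub_self]
  intro x y
  refine perfect_zero_aux hperf (p.flip y) (fun u v => ?_) x
  rw [LinearMap.flip_apply, hp.ax2, hza _ (hpa v y), hza _ (hpa u y), sub_self]
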